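/- Let m ≥ 2 and let f̃ : Ω̃ → ℝ_{0,m} be real-analytic on an open set Ω̃ ⊆ ℝ^{m−1} containing the origin. Then there is an open neighbourhood U of the origin in ℝ^m on which the series f(X₁,…,X_m) = Σ_{k=0}^∞ (1/k!) X_mᵏ (e_m ∂̃)ᵏ [f̃](X₁,…,X_{m−1}) converges, where (e_m ∂̃)[g] = e_m · Σ_{α=1}^{m−1} e_α · ∂g/∂X_α, and the resulting function f is monogenic on U (∂f = 0) and satisfies f(X₁,…,X_{m−1},0) = f̃(X₁,…,X_{m−1}) near the origin. -/

import Mathlib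

noncomputable section

/-- The negative definite quadratic form `-∑ vᵢ²` on `K^m`. -/
def negQ (K : Type) [Field K] (m : ℕ) : QuadraticForm K (Fin m → K) :=
  QuadraticMap.weightedSumSquares K (fun _ : Fin m => (-1 : K))

/-- The real Clifford algebra `ℝ_{0,m}`. -/
abbrev ClR (m : ℕ) : Type := CliffordAlgebra (negQ ℝ m)

/-- The generators `e_α` of `ℝ_{0,m}`, satisfying `e_α e_β + e_β e_α = -2 δ_{αβ}`. -/
def er (m : ℕ) (α : Fin m) : ClR m := CliffordAlgebra.ι (negQ ℝ m) (Pi.single α 1)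

/-- `f` has directional derivative `d` at `z` in direction `v` (componentwise, i.e. tested
against all linear functionals on the finite-dimensional space `ℝ_{0,m}`). -/
def HasDirDerivR {m k : ℕ} (f : (Fin k → ℝ) → ClR m) (z v : Fin k → ℝ) (d : ClR m) : Prop :=
  ∀ φ : ClR m →ₗ[ℝ] ℝ, HasDerivAt (fun t : ℝ => φ (f (z + t • v))) (φ d) 0

/-- The directional derivative of `f` at `z` in direction `v` (junk value if it does not exist). -/
def dirDerivR {m k : ℕ} (f : (Fin k → ℝ) → ClR m) (v z : Fin k → ℝ) : ClR m :=
  letI : Nonempty (ClR m) := ⟨0⟩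
  Classical.epsilon fun d => HasDirDerivR f z v d

/-- The Dirac operator `∂ f = ∑_α e_α ∂f/∂X_α` on `ℝ_{0,m}`-valued functions on `ℝ^m`. -/
def diracR (m : ℕ) (f : (Fin m → ℝ) → ClR m) (X : Fin m → ℝ) : ClR m :=
  ∑ α : Fin m, er m α * dirDerivR f (Pi.single α 1) X

/-- The restricted Dirac operator `∂̃ g = ∑_{α<m} e_α ∂g/∂X_α` on functions of `m-1` variables. -/
def diracTR (m : ℕ) (g : (Fin (m - 1) → ℝ) → ClR m) (x : Fin (m - 1) → ℝ) : ClR m :=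
  ∑ α : Fin (m - 1), er m (Fin.castLE (Nat.sub_le m 1) α) * dirDerivR g (Pi.single α 1) x

/-- The embedding `ℝ^{m-1} ≃ {X ∈ ℝ^m : X_m = 0} ⊆ ℝ^m`. -/
def embR (m : ℕ) (x : Fin (m - 1) → ℝ) : Fin m → ℝ :=
  fun i => if h : (i : ℕ) < m - 1 then x ⟨i, h⟩ else 0

/-- `f` is real-analytic on `Ω` (componentwise). -/
def RealAnalyticOnR {m k : ℕ} (f : (Fin k → ℝ) → ClR m) (Ω : Set (Fin k → ℝ)) : Prop :=
  ∀ φ : ClR m →ₗ[ℝ] ℝ, AnalyticOnNhd ℝ (fun x => φ (f x)) Ω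

/-- `f` is (left) monogenic on the open set `Ω ⊆ ℝ^m`: it is continuously differentiable
(componentwise) and satisfies `∂ f = 0` on `Ω`. -/
def MonogenicOn (m : ℕ) (f : (Fin m → ℝ) → ClR m) (Ω : Set (Fin m → ℝ)) : Prop :=
  (∀ φ : ClR m →ₗ[ℝ] ℝ, ContDiffOn ℝ 1 (fun X => φ (f X)) Ω) ∧
    ∀ X ∈ Ω, diracR m f X = 0

section Analysis

open Metric
open scoped NNReal ENNReal Nat

variable {E F G : Type*} [NormedAddCommGroup E] [NormedSpace ℝ E]
  [NormedAddCommGroup F] [NormedSpace ℝ F] [NormedAddCommGroup G] [NormedSpace ℝ G]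

/-- Cauchy estimates, uniform on a neighbourhood of a point of analyticity. -/
theorem AnalyticAt.exists_norm_iteratedFDeriv_le [CompleteSpace F] {f : E → F} {x : E}
    (hf : AnalyticAt ℝ f x) :
    ∃ ε > 0, ∃ C R : ℝ, 0 ≤ C ∧ 0 ≤ R ∧ ∀ y ∈ ball x ε, AnalyticAt ℝ f y ∧
      ∀ n : ℕ, ‖iteratedFDeriv ℝ n f y‖ ≤ C * n ! * R ^ n := by
  obtain ⟨p, r, hp⟩ := hf
  obtain ⟨ρ, hρ0, hρr⟩ := ENNReal.lt_iff_exists_nnreal_btwn.1 hp.r_pos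
  have hρ : 0 < ρ := by exact_mod_cast hρ0
  set s : ℝ≥0 := ρ / 2 with hs
  have hs0 : 0 < s := by positivity
  have hss : ((s : ℝ≥0∞) + s) < p.radius := by
    have : (s : ℝ≥0∞) + s = ρ := by rw [← ENNReal.coe_add, hs, add_halves]
    rw [this]; exact hρr.trans_le hp.r_le
  have hsum := (NNReal.summable_sigma.1 (p.changeOriginSeries_summable_aux₁ hss)).2
  set S : ℝ≥0 := ∑' k : ℕ, ∑' t : Σ l : ℕ, { t : Finset (Fin (k + l)) // t.card = l },
    ‖p (k + t.1)‖₊ * s ^ t.1 * s ^ k with hS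
  refine ⟨s, hs0, S, (s : ℝ)⁻¹, S.2, by positivity, fun y hy => ?_⟩
  obtain ⟨z, rfl⟩ : ∃ z, y = x + z := ⟨y - x, by abel⟩
  have hz : ‖z‖₊ < s := by
    rw [mem_ball, dist_eq_norm, add_sub_cancel_left] at hy
    exact_mod_cast hy
  have hsr : (s : ℝ≥0∞) < p.radius := lt_of_le_of_lt le_self_add hss
  have hzr : (‖z‖₊ : ℝ≥0∞) < r := by
    refine lt_trans (b := (ρ : ℝ≥0∞)) ?_ hρr
    exact_mod_cast hz.trans (half_lt_self hρ)
  have hq := hp.changeOrigin hzr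
  refine ⟨hq.analyticAt, fun n => ?_⟩
  have hco : ‖p.changeOrigin z n‖₊ * s ^ n ≤ S := by
    have h1 := p.nnnorm_changeOrigin_le n (lt_trans (by exact_mod_cast hz) hsr)
    have h2 : (∑' t : Σ l : ℕ, { t : Finset (Fin (n + l)) // t.card = l },
        ‖p (n + t.1)‖₊ * ‖z‖₊ ^ t.1) ≤
        ∑' t : Σ l : ℕ, { t : Finset (Fin (n + l)) // t.card = l },
        ‖p (n + t.1)‖₊ * s ^ t.1 := by
      have h3 := p.changeOriginSeries_summable_aux₂ hsr n
      have h4 : ∀ t : Σ l : ℕ, { t : Finset (Fin (n + l)) // t.card = l },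
        ‖p (n + t.1)‖₊ * ‖z‖₊ ^ t.1 ≤ ‖p (n + t.1)‖₊ * s ^ t.1 := fun t => by gcongr
      exact (NNReal.summable_of_le h4 h3).tsum_le_tsum h4 h3
    calc ‖p.changeOrigin z n‖₊ * s ^ n
        ≤ (∑' t : Σ l : ℕ, { t : Finset (Fin (n + l)) // t.card = l },
            ‖p (n + t.1)‖₊ * s ^ t.1) * s ^ n := by gcongr; exact h1.trans h2
      _ = ∑' t : Σ l : ℕ, { t : Finset (Fin (n + l)) // t.card = l },
            ‖p (n + t.1)‖₊ * s ^ t.1 * s ^ n := NNReal.tsum_mul_right _ _ |>.symm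
      _ ≤ S := hsum.le_tsum n (fun _ _ => zero_le)
  have hco' : ‖p.changeOrigin z n‖ ≤ S * (s : ℝ)⁻¹ ^ n := by
    rw [inv_pow, ← div_eq_mul_inv, le_div_iff₀ (by positivity)]
    exact_mod_cast hco
  refine ContinuousMultilinearMap.opNorm_le_bound (by positivity) fun v => ?_
  rw [hq.iteratedFDeriv_eq_sum_of_completeSpace]
  calc ‖∑ σ : Equiv.Perm (Fin n), p.changeOrigin z n (fun i => v (σ i))‖
      ≤ ∑ σ : Equiv.Perm (Fin n), ‖p.changeOrigin z n (fun i => v (σ i))‖ := norm_sum_le _ _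
    _ ≤ ∑ _σ : Equiv.Perm (Fin n), S * (s : ℝ)⁻¹ ^ n * ∏ i, ‖v i‖ := by
        refine Finset.sum_le_sum fun σ _ => ?_
        refine ((p.changeOrigin z n).le_opNorm _).trans ?_
        rw [Equiv.prod_comp σ (fun i => ‖v i‖)]
        gcongr
    _ = S * n ! * (s : ℝ)⁻¹ ^ n * ∏ i, ‖v i‖ := by
        simp [Fintype.card_perm]; ring

/-- The constant-coefficient homogeneous first-order differential operator with symbol `L`. -/
def firstOrderOp (L : (E →L[ℝ] F) →L[ℝ] F) (g : E → F) (x : E) : F := L (fderiv ℝ g x)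

theorem analyticOnNhd_iterate_firstOrderOp [CompleteSpace F] (L : (E →L[ℝ] F) →L[ℝ] F)
    {g : E → F} {V : Set E} (hg : AnalyticOnNhd ℝ g V) (k : ℕ) :
    AnalyticOnNhd ℝ ((firstOrderOp L)^[k] g) V := by
  induction k with
  | zero => exact hg
  | succ k ih =>
    rw [Function.iterate_succ_apply']
    exact L.comp_analyticOnNhd ih.fderiv

theorem norm_iteratedFDeriv_iterate_firstOrderOp_le [CompleteSpace F]
    (L : (E →L[ℝ] F) →L[ℝ] F) {g : E → F} {V : Set E} (hg : AnalyticOnNhd ℝ g V)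
    {x : E} (hx : x ∈ V) (k n : ℕ) :
    ‖iteratedFDeriv ℝ n ((firstOrderOp L)^[k] g) x‖ ≤
      ‖L‖ ^ k * ‖iteratedFDeriv ℝ (n + k) g x‖ := by
  induction k generalizing n with
  | zero => simp
  | succ k ih =>
    rw [Function.iterate_succ_apply']
    have h := analyticOnNhd_iterate_firstOrderOp L hg k
    calc ‖iteratedFDeriv ℝ n (firstOrderOp L ((firstOrderOp L)^[k] g)) x‖
        ≤ ‖L‖ * ‖iteratedFDeriv ℝ n (fderiv ℝ ((firstOrderOp L)^[k] g)) x‖ :=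
          L.norm_iteratedFDeriv_comp_left (N := n) (h.fderiv x hx).contDiffAt le_rfl
      _ = ‖L‖ * ‖iteratedFDeriv ℝ (n + 1) ((firstOrderOp L)^[k] g) x‖ := by
          rw [norm_iteratedFDeriv_fderiv]
      _ ≤ ‖L‖ * (‖L‖ ^ k * ‖iteratedFDeriv ℝ (n + 1 + k) g x‖) := by gcongr; exact ih _
      _ = ‖L‖ ^ (k + 1) * ‖iteratedFDeriv ℝ (n + (k + 1)) g x‖ := by
          rw [add_right_comm, add_assoc n k 1]; ring

/-- The `k`-th term of the Cauchy–Kovalevskaya series with coefficient functions `h`. -/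
def ckTerm (ℓ : G →L[ℝ] ℝ) (P : G →L[ℝ] E) (h : ℕ → E → F) (k : ℕ) (X : G) : F :=
  ((k ! : ℝ)⁻¹ * ℓ X ^ k) • h k (P X)

/-- The derivative of `ckTerm`. -/
def ckTermDeriv (ℓ : G →L[ℝ] ℝ) (P : G →L[ℝ] E) (h : ℕ → E → F) (k : ℕ) (X : G) :
    G →L[ℝ] F :=
  ((k ! : ℝ)⁻¹ * ℓ X ^ k) • (fderiv ℝ (h k) (P X)).comp P +
    ((k ! : ℝ)⁻¹ * (k * ℓ X ^ (k - 1))) • ℓ.smulRight (h k (P X))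

theorem hasFDerivAt_ckTerm (ℓ : G →L[ℝ] ℝ) (P : G →L[ℝ] E) {h : ℕ → E → F} {k : ℕ} {X : G}
    (hd : DifferentiableAt ℝ (h k) (P X)) :
    HasFDerivAt (ckTerm ℓ P h k) (ckTermDeriv ℓ P h k X) X := by
  have h1 : HasFDerivAt (fun X => h k (P X)) ((fderiv ℝ (h k) (P X)).comp P) X :=
    hd.hasFDerivAt.comp X P.hasFDerivAt
  have h2 := ((ℓ.hasFDerivAt (x := X)).pow k).const_mul ((k ! : ℝ)⁻¹)
  refine (h2.smul h1).congr_fderiv ?_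
  ext v
  simp [ckTermDeriv, smul_smul, mul_assoc]

theorem norm_ckTermDeriv_le (ℓ : G →L[ℝ] ℝ) (P : G →L[ℝ] E) {h : ℕ → E → F} {k : ℕ} {X : G}
    {C B ρ : ℝ} (hX : |ℓ X| ≤ ρ)
    (hh : ‖h k (P X)‖ ≤ C * k ! * B ^ k)
    (hd : ‖fderiv ℝ (h k) (P X)‖ ≤ C * (k + 1)! * B ^ (k + 1)) :
    ‖ckTermDeriv ℓ P h k X‖ ≤
      C * B * ‖P‖ * ((k + 1) * (ρ * B) ^ k) + C * B * ‖ℓ‖ * (k * (ρ * B) ^ (k - 1)) := by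
  have hρ : 0 ≤ ρ := (abs_nonneg _).trans hX
  have hk : (k ! : ℝ) ≠ 0 := by positivity
  refine (norm_add_le _ _).trans (add_le_add ?_ ?_)
  · rw [norm_smul, norm_mul, norm_inv, norm_pow, Real.norm_eq_abs (ℓ X), Real.norm_natCast]
    calc (k ! : ℝ)⁻¹ * |ℓ X| ^ k * ‖(fderiv ℝ (h k) (P X)).comp P‖
        ≤ (k ! : ℝ)⁻¹ * ρ ^ k * ((C * (k + 1)! * B ^ (k + 1)) * ‖P‖) := by
          gcongr
          exact (ContinuousLinearMap.opNorm_comp_le _ _).trans (by gcongr)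
      _ = _ := by
          rw [Nat.factorial_succ]; push_cast; field_simp; ring
  · rw [norm_smul, norm_mul, norm_inv, norm_mul, norm_pow, Real.norm_eq_abs (ℓ X),
      Real.norm_natCast, Real.norm_natCast, ContinuousLinearMap.norm_smulRight_apply]
    rcases k with _ | k
    · simp
    calc ((k + 1)! : ℝ)⁻¹ * ((k + 1 : ℕ) * |ℓ X| ^ (k + 1 - 1)) * (‖ℓ‖ * ‖h (k + 1) (P X)‖)
        ≤ ((k + 1)! : ℝ)⁻¹ * ((k + 1 : ℕ) * ρ ^ (k + 1 - 1)) *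
          (‖ℓ‖ * (C * (k + 1)! * B ^ (k + 1))) := by gcongr
      _ = _ := by
          rw [Nat.add_sub_cancel]; field_simp; ring

/-- Convergence and termwise differentiation of the Cauchy–Kovalevskaya series. -/
theorem exists_ball_hasFDerivAt_tsum_ckTerm [CompleteSpace F] (ℓ : G →L[ℝ] ℝ) (P : G →L[ℝ] E)
    {h : ℕ → E → F} {ε C B : ℝ} (hε : 0 < ε) (hB : 0 ≤ B)
    (han : ∀ k, AnalyticOnNhd ℝ (h k) (ball 0 ε))
    (hh : ∀ k, ∀ x ∈ ball (0 : E) ε, ‖h k x‖ ≤ C * k ! * B ^ k)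
    (hd : ∀ k, ∀ x ∈ ball (0 : E) ε, ‖fderiv ℝ (h k) x‖ ≤ C * (k + 1)! * B ^ (k + 1)) :
    ∃ δ > 0, (∀ X ∈ ball (0 : G) δ, P X ∈ ball (0 : E) ε) ∧
      (∀ X ∈ ball (0 : G) δ, Summable fun k => ckTerm ℓ P h k X) ∧
      (∀ X ∈ ball (0 : G) δ, Summable fun k => ckTermDeriv ℓ P h k X) ∧
      (∀ X ∈ ball (0 : G) δ,
        Summable fun k => ((k ! : ℝ)⁻¹ * ℓ X ^ k) • fderiv ℝ (h k) (P X)) ∧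
      (∀ X ∈ ball (0 : G) δ, HasFDerivAt (fun Y => ∑' k, ckTerm ℓ P h k Y)
        (∑' k, ckTermDeriv ℓ P h k X) X) ∧
      ContDiffOn ℝ 1 (fun Y => ∑' k, ckTerm ℓ P h k Y) (ball 0 δ) := by
  set ρ : ℝ := 1 / (2 * (B + 1)) with hρ
  have hρ0 : 0 < ρ := by positivity
  have hρB0 : 0 ≤ ρ * B := by positivity
  have hρB : ρ * B < 1 := by
    rw [hρ, div_mul_eq_mul_div, div_lt_one (by positivity)]; linarith
  have hnorm : ‖ρ * B‖ < 1 := by rwa [Real.norm_of_nonneg hρB0]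
  obtain ⟨δ, hδ, hsub⟩ : ∃ δ > 0, ball (0 : G) δ ⊆ {X | P X ∈ ball (0 : E) ε ∧ |ℓ X| < ρ} := by
    rw [← Metric.mem_nhds_iff]
    refine IsOpen.mem_nhds ?_ (by simp [hε, hρ0])
    exact (isOpen_ball.preimage P.continuous).inter
      (isOpen_lt (continuous_abs.comp ℓ.continuous) continuous_const)
  have hP : ∀ X ∈ ball (0 : G) δ, P X ∈ ball (0 : E) ε := fun X hX => (hsub hX).1
  have hs2 : Summable fun k : ℕ => ((k : ℝ) + 1) * (ρ * B) ^ k := by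
    have h1 := summable_pow_mul_geometric_of_norm_lt_one 1 hnorm
    simpa [add_mul] using h1.add (summable_geometric_of_norm_lt_one hnorm)
  have hs1 : Summable fun k : ℕ => (k : ℝ) * (ρ * B) ^ (k - 1) := by
    refine (summable_nat_add_iff 1).1 ?_
    simpa using hs2
  have hu : Summable fun k : ℕ => C * B * ‖P‖ * ((k + 1) * (ρ * B) ^ k) +
      C * B * ‖ℓ‖ * (k * (ρ * B) ^ (k - 1)) := (hs2.mul_left _).add (hs1.mul_left _)
  have hfd : ∀ (k : ℕ) (X : G), X ∈ ball (0 : G) δ →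
      HasFDerivAt (ckTerm ℓ P h k) (ckTermDeriv ℓ P h k X) X := fun k X hX =>
    hasFDerivAt_ckTerm ℓ P (han k _ (hP X hX)).differentiableAt
  have hbd : ∀ (k : ℕ) (X : G), X ∈ ball (0 : G) δ → ‖ckTermDeriv ℓ P h k X‖ ≤
      C * B * ‖P‖ * ((k + 1) * (ρ * B) ^ k) + C * B * ‖ℓ‖ * (k * (ρ * B) ^ (k - 1)) :=
    fun k X hX => norm_ckTermDeriv_le ℓ P (hsub hX).2.le (hh k _ (hP X hX))
      (hd k _ (hP X hX))
  have h00 : (0 : G) ∈ ball (0 : G) δ := mem_ball_self hδ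
  have hsum0 : Summable fun k => ckTerm ℓ P h k 0 := by
    refine summable_of_ne_finset_zero (s := {0}) fun k hk => ?_
    have : k ≠ 0 := by simpa using hk
    simp [ckTerm, this]
  have hpc : IsPreconnected (ball (0 : G) δ) := (convex_ball 0 δ).isPreconnected
  have hderiv : ∀ X ∈ ball (0 : G) δ, HasFDerivAt (fun Y => ∑' k, ckTerm ℓ P h k Y)
      (∑' k, ckTermDeriv ℓ P h k X) X := fun X hX =>
    hasFDerivAt_tsum_of_isPreconnected hu isOpen_ball hpc hfd hbd h00 hsum0 hX
  refine ⟨δ, hδ, hP, fun X hX => ?_, fun X hX => ?_, fun X hX => ?_, hderiv, ?_⟩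
  · exact summable_of_summable_hasFDerivAt_of_isPreconnected hu isOpen_ball hpc hfd hbd h00
      hsum0 hX
  · exact .of_norm_bounded hu fun k => hbd k X hX
  · refine .of_norm_bounded (hs2.mul_left (C * B)) fun k => ?_
    rw [norm_smul, norm_mul, norm_inv, norm_pow, Real.norm_eq_abs (ℓ X), Real.norm_natCast]
    have hk : (k ! : ℝ) ≠ 0 := by positivity
    calc (k ! : ℝ)⁻¹ * |ℓ X| ^ k * ‖fderiv ℝ (h k) (P X)‖
        ≤ (k ! : ℝ)⁻¹ * ρ ^ k * (C * (k + 1)! * B ^ (k + 1)) := by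
          gcongr
          · exact (hsub hX).2.le
          · exact hd k _ (hP X hX)
      _ = _ := by
          rw [Nat.factorial_succ]; push_cast; field_simp; ring
  · rw [← zero_add (1 : WithTop ℕ∞), contDiffOn_succ_iff_fderiv_of_isOpen isOpen_ball,
      contDiffOn_zero]
    refine ⟨fun X hX => (hderiv X hX).differentiableAt.differentiableWithinAt, by simp, ?_⟩
    have hcont : ContinuousOn (fun X => ∑' k, ckTermDeriv ℓ P h k X) (ball 0 δ) := by
      refine continuousOn_tsum (fun k => ?_) hu hbd
      have h1 : ContinuousOn (fun X => h k (P X)) (ball 0 δ) :=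
        (han k).continuousOn.comp P.continuous.continuousOn hP
      have h2 : ContinuousOn (fun X => fderiv ℝ (h k) (P X)) (ball 0 δ) :=
        (han k).fderiv.continuousOn.comp P.continuous.continuousOn hP
      have h3 : ContinuousOn (fun X => ℓ.smulRight (h k (P X))) (ball 0 δ) :=
        (ContinuousLinearMap.smulRightL ℝ G F ℓ).continuous.comp_continuousOn h1
      have h4 : Continuous fun X => ℓ X := ℓ.continuous
      exact ((by fun_prop : Continuous fun X => (k ! : ℝ)⁻¹ * ℓ X ^ k).continuousOn.smul
          (h2.clm_comp continuousOn_const)).add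
        ((by fun_prop : Continuous fun X => (k ! : ℝ)⁻¹ * (k * ℓ X ^ (k - 1))).continuousOn.smul
          h3)
    exact hcont.congr fun X hX => (hderiv X hX).fderiv

end Analysis

section Clifford

open Metric

instance ClR.instFinite (m : ℕ) : Module.Finite ℝ (ClR m) :=
  haveI : Module.Finite ℝ (ExteriorAlgebra ℝ (Fin m → ℝ)) :=
    Module.Finite.of_basis (Pi.basisFun ℝ (Fin m)).ExteriorAlgebra
  Module.Finite.equiv (CliffordAlgebra.equivExterior (negQ ℝ m)).symm

/-- The supremum norm on `ℝ_{0,m}` with respect to some basis. -/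
abbrev ClR.normedAddCommGroup (m : ℕ) : NormedAddCommGroup (ClR m) :=
  NormedAddCommGroup.induced _ _ (Module.finBasis ℝ (ClR m)).equivFun
    (Module.finBasis ℝ (ClR m)).equivFun.injective

attribute [local instance] ClR.normedAddCommGroup

/-- `ℝ_{0,m}` is a normed space for `ClR.normedAddCommGroup`. -/
abbrev ClR.normedSpace (m : ℕ) : NormedSpace ℝ (ClR m) :=
  NormedSpace.induced ℝ _ _ (Module.finBasis ℝ (ClR m)).equivFun

attribute [local instance] ClR.normedSpace

theorem er_mul_self (m : ℕ) (α : Fin m) : er m α * er m α = -1 := by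
  have h : negQ ℝ m (Pi.single α 1) = -1 := by
    simp [negQ, QuadraticMap.weightedSumSquares_apply, Pi.single_apply]
  rw [er, CliffordAlgebra.ι_sq_scalar, h, map_neg, map_one]

theorem ClR.ext_linearMap {m : ℕ} {a b : ClR m} (h : ∀ φ : ClR m →ₗ[ℝ] ℝ, φ a = φ b) : a = b :=
  (Module.forall_dual_apply_eq_zero_iff ℝ (a - b)).1 (fun φ => by
    rw [map_sub, h φ, sub_self]) |> sub_eq_zero.1

theorem HasFDerivAt.dirDerivR_eq {m k : ℕ} {f : (Fin k → ℝ) → ClR m}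
    {f' : (Fin k → ℝ) →L[ℝ] ClR m} {z : Fin k → ℝ} (hf : HasFDerivAt f f' z) (v : Fin k → ℝ) :
    dirDerivR f v z = f' v := by
  have h : HasDirDerivR f z v (f' v) := fun φ =>
    (LinearMap.toContinuousLinearMap φ).hasFDerivAt.comp_hasDerivAt (0 : ℝ)
      (hf.hasLineDerivAt v)
  have h' : HasDirDerivR f z v (dirDerivR f v z) := Classical.epsilon_spec ⟨_, h⟩
  exact ClR.ext_linearMap fun φ => (h' φ).unique (h φ)

theorem RealAnalyticOnR.analyticOnNhd {m k : ℕ} {f : (Fin k → ℝ) → ClR m}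
    {Ω : Set (Fin k → ℝ)} (hf : RealAnalyticOnR f Ω) : AnalyticOnNhd ℝ f Ω := by
  intro x hx
  have h : f = fun x => ∑ i, (Module.finBasis ℝ (ClR m)).coord i (f x) •
      Module.finBasis ℝ (ClR m) i := by
    funext x
    exact ((Module.finBasis ℝ (ClR m)).sum_repr (f x)).symm
  rw [h]
  exact Finset.analyticAt_fun_sum _ fun i _ => (hf _ x hx).smul analyticAt_const

/-- Left multiplication by `a` in `ℝ_{0,m}` as a continuous linear map. -/
def ClR.mulLeftL {m : ℕ} (a : ClR m) : ClR m →L[ℝ] ClR m :=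
  LinearMap.toContinuousLinearMap (LinearMap.mulLeft ℝ a)

@[simp]
theorem ClR.mulLeftL_apply {m : ℕ} (a b : ClR m) : ClR.mulLeftL a b = a * b := rfl

/-- The symbol `T ↦ ∑_α e_{ι α} T(e_α)` of a Dirac operator in the variables indexed by `ι`. -/
def diracSymbol {m k : ℕ} (ι : Fin k → Fin m) : ((Fin k → ℝ) →L[ℝ] ClR m) →L[ℝ] ClR m :=
  ∑ α, (ClR.mulLeftL (er m (ι α))).comp
    (ContinuousLinearMap.apply ℝ (ClR m) (Pi.single α (1 : ℝ)))

theorem diracSymbol_apply {m k : ℕ} (ι : Fin k → Fin m) (T : (Fin k → ℝ) →L[ℝ] ClR m) :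
    diracSymbol ι T = ∑ α, er m (ι α) * T (Pi.single α 1) := by
  simp [diracSymbol, sum_apply]

theorem HasFDerivAt.diracR_eq {m : ℕ} {f : (Fin m → ℝ) → ClR m}
    {f' : (Fin m → ℝ) →L[ℝ] ClR m} {X : Fin m → ℝ} (hf : HasFDerivAt f f' X) :
    diracR m f X = diracSymbol id f' := by
  simp [diracR, diracSymbol_apply, hf.dirDerivR_eq]

theorem HasFDerivAt.diracTR_eq {m : ℕ} {g : (Fin (m - 1) → ℝ) → ClR m}
    {g' : (Fin (m - 1) → ℝ) →L[ℝ] ClR m} {x : Fin (m - 1) → ℝ} (hg : HasFDerivAt g g' x) :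
    diracTR m g x = diracSymbol (Fin.castLE (Nat.sub_le m 1)) g' := by
  simp [diracTR, diracSymbol_apply, hg.dirDerivR_eq]

theorem iterate_mul_diracTR_eqOn {m : ℕ} (e : ClR m) {g : (Fin (m - 1) → ℝ) → ClR m}
    {V : Set (Fin (m - 1) → ℝ)} (hV : IsOpen V) (hg : AnalyticOnNhd ℝ g V) (k : ℕ) :
    Set.EqOn ((fun (g : (Fin (m - 1) → ℝ) → ClR m) x => e * diracTR m g x)^[k] g)
      ((firstOrderOp ((ClR.mulLeftL e).comp
        (diracSymbol (Fin.castLE (Nat.sub_le m 1)))))^[k] g) V := by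
  induction k with
  | zero => exact fun x _ => rfl
  | succ k ih =>
    intro x hx
    rw [Function.iterate_succ_apply', Function.iterate_succ_apply']
    have h := ((analyticOnNhd_iterate_firstOrderOp ((ClR.mulLeftL e).comp
      (diracSymbol (Fin.castLE (Nat.sub_le m 1)))) hg k) x hx).differentiableAt.hasFDerivAt
    have h' := h.congr_of_eventuallyEq (ih.eventuallyEq_of_mem (hV.mem_nhds hx))
    simp only [h'.diracTR_eq, firstOrderOp, ContinuousLinearMap.comp_apply, ClR.mulLeftL_apply]

/-- The projection `ℝ^m → ℝ^{m-1}` onto the first `m - 1` coordinates. -/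
def projInit (m : ℕ) : (Fin m → ℝ) →L[ℝ] (Fin (m - 1) → ℝ) :=
  ContinuousLinearMap.pi fun i => ContinuousLinearMap.proj (Fin.castLE (Nat.sub_le m 1) i)

theorem projInit_apply (m : ℕ) (X : Fin m → ℝ) :
    projInit m X = fun i => X (Fin.castLE (Nat.sub_le m 1) i) := rfl

theorem projInit_embR (m : ℕ) (x : Fin (m - 1) → ℝ) : projInit m (embR m x) = x := by
  ext i
  simp [projInit_apply, embR]

/-- The full Dirac symbol splits into its tangential and normal parts. -/
theorem diracSymbol_id_smul_comp_add (m : ℕ) (hm : m - 1 < m) (a b : ℝ)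
    (S : (Fin (m - 1) → ℝ) →L[ℝ] ClR m) (c : ClR m) :
    diracSymbol id (a • S.comp (projInit m) +
      b • (ContinuousLinearMap.proj (R := ℝ) (φ := fun _ : Fin m => ℝ) ⟨m - 1, hm⟩).smulRight c) =
      a • diracSymbol (Fin.castLE (Nat.sub_le m 1)) S + b • (er m ⟨m - 1, hm⟩ * c) := by
  obtain ⟨n, rfl⟩ : ∃ n, m = n + 1 := ⟨m - 1, by omega⟩
  have h1 : ∀ α : Fin n, projInit (n + 1) (Pi.single α.castSucc 1) = Pi.single α 1 := by
    intro α
    ext i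
    simp only [projInit_apply, Pi.single_apply]
    exact if_congr (Fin.castSucc_inj (a := i) (b := α)) rfl rfl
  have h2 : projInit (n + 1) (Pi.single (Fin.last n) 1) = 0 := by
    ext i
    simp only [projInit_apply, Pi.single_apply]
    exact if_neg (Fin.castSucc_lt_last i).ne
  have h3 : ∀ α : Fin n, (Pi.single α.castSucc 1 : Fin (n + 1) → ℝ) (Fin.last n) = 0 := fun α =>
    Pi.single_eq_of_ne (Fin.castSucc_lt_last α).ne' _
  have h4 : (⟨n + 1 - 1, hm⟩ : Fin (n + 1)) = Fin.last n := rfl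
  rw [diracSymbol_apply, diracSymbol_apply, Fin.sum_univ_castSucc, h4]
  simp only [id, add_apply, smul_apply, ContinuousLinearMap.comp_apply, h1, h2, h3,
    ContinuousLinearMap.smulRight_apply, ContinuousLinearMap.proj_apply, Pi.single_eq_same,
    zero_smul, smul_zero, add_zero, map_zero, zero_add, one_smul, mul_smul_comm,
    Finset.smul_sum]
  rfl

theorem diracSymbol_tsum_ckTermDeriv_eq_zero {m : ℕ} (hm : m - 1 < m)
    {h : ℕ → (Fin (m - 1) → ℝ) → ClR m} {X : Fin m → ℝ}
    (hsucc : ∀ k, h (k + 1) (projInit m X) = er m ⟨m - 1, hm⟩ *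
      diracSymbol (Fin.castLE (Nat.sub_le m 1)) (fderiv ℝ (h k) (projInit m X)))
    (hs : Summable fun k =>
      ckTermDeriv (ContinuousLinearMap.proj ⟨m - 1, hm⟩) (projInit m) h k X)
    (hs' : Summable fun k : ℕ =>
      ((k.factorial : ℝ)⁻¹ * X ⟨m - 1, hm⟩ ^ k) • fderiv ℝ (h k) (projInit m X)) :
    diracSymbol id (∑' k, ckTermDeriv (ContinuousLinearMap.proj ⟨m - 1, hm⟩) (projInit m) h k X) =
      0 := by
  set t := X ⟨m - 1, hm⟩
  set a : ℕ → ClR m := fun k => ((k.factorial : ℝ)⁻¹ * t ^ k) •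
    diracSymbol (Fin.castLE (Nat.sub_le m 1)) (fderiv ℝ (h k) (projInit m X)) with ha
  set b : ℕ → ClR m := fun k => ((k.factorial : ℝ)⁻¹ * (k * t ^ (k - 1))) •
    (er m ⟨m - 1, hm⟩ * h k (projInit m X)) with hb
  have hab : ∀ k, diracSymbol id
      (ckTermDeriv (ContinuousLinearMap.proj ⟨m - 1, hm⟩) (projInit m) h k X) = a k + b k :=
    fun k => diracSymbol_id_smul_comp_add m hm _ _ _ _
  have hbs : ∀ k, b (k + 1) = -a k := by
    intro k
    simp only [hb, ha, hsucc]
    rw [← mul_assoc (er m _) (er m _), er_mul_self, neg_one_mul, smul_neg, Nat.factorial_succ,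
      Nat.add_sub_cancel]
    congr 2
    push_cast
    field_simp
  have hb0 : b 0 = 0 := by simp [hb]
  have hsa : Summable a := by
    simpa only [map_smul] using
      (diracSymbol (Fin.castLE (Nat.sub_le m 1))).summable hs'
  have hsb : Summable b := (summable_nat_add_iff 1).1 (by simpa only [hbs] using hsa.neg)
  rw [ContinuousLinearMap.map_tsum _ hs]
  simp only [hab]
  rw [hsa.tsum_add hsb, hsb.tsum_eq_zero_add, hb0, zero_add]
  simp only [hbs, tsum_neg, add_neg_cancel]

/-- The Cauchy–Kovalevskaya extension on a ball. -/
theorem exists_ball_ckTerm_extension {m : ℕ} (hm : m - 1 < m) {Ω : Set (Fin (m - 1) → ℝ)}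
    (h0 : (0 : Fin (m - 1) → ℝ) ∈ Ω) {g : (Fin (m - 1) → ℝ) → ClR m}
    (hg : RealAnalyticOnR g Ω) :
    ∃ δ > 0, ∃ f : (Fin m → ℝ) → ClR m,
      (∀ X ∈ ball (0 : Fin m → ℝ) δ, ∀ φ : ClR m →ₗ[ℝ] ℝ,
        HasSum (fun k : ℕ => φ (((k.factorial : ℝ)⁻¹ * X ⟨m - 1, hm⟩ ^ k) •
          ((fun (g : (Fin (m - 1) → ℝ) → ClR m) x =>
            er m ⟨m - 1, hm⟩ * diracTR m g x)^[k] g) (projInit m X))) (φ (f X))) ∧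
      MonogenicOn m f (ball 0 δ) := by
  obtain ⟨ε, hε, C, R, hC, hR, hb⟩ := (hg.analyticOnNhd 0 h0).exists_norm_iteratedFDeriv_le
  set V := ball (0 : Fin (m - 1) → ℝ) ε
  have hV : AnalyticOnNhd ℝ g V := fun y hy => (hb y hy).1
  set e := er m ⟨m - 1, hm⟩
  set L : ((Fin (m - 1) → ℝ) →L[ℝ] ClR m) →L[ℝ] ClR m :=
    (ClR.mulLeftL e).comp (diracSymbol (Fin.castLE (Nat.sub_le m 1)))
  set h : ℕ → (Fin (m - 1) → ℝ) → ClR m := fun k => (firstOrderOp L)^[k] g with hh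
  have han : ∀ k, AnalyticOnNhd ℝ (h k) V := analyticOnNhd_iterate_firstOrderOp L hV
  set B : ℝ := (‖L‖ + 1) * R with hB
  have hbound : ∀ n k, ∀ x ∈ V, ‖iteratedFDeriv ℝ n (h k) x‖ ≤
      (‖L‖ + 1) ^ k * (C * (n + k).factorial * R ^ (n + k)) := by
    intro n k x hx
    refine (norm_iteratedFDeriv_iterate_firstOrderOp_le L hV hx k n).trans ?_
    gcongr
    · linarith
    · exact (hb x hx).2 _
  obtain ⟨δ, hδ, hP, hs, hsd, hsf, hder, hcd⟩ := exists_ball_hasFDerivAt_tsum_ckTerm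
    (ContinuousLinearMap.proj (R := ℝ) (φ := fun _ : Fin m => ℝ) ⟨m - 1, hm⟩) (projInit m)
    (C := C) (B := B) hε (by positivity) han
    (fun k x hx => by
      refine (norm_iteratedFDeriv_zero (𝕜 := ℝ) (f := h k) (x := x)).symm.le.trans
        ((hbound 0 k x hx).trans_eq ?_)
      rw [zero_add, hB, mul_pow]; ring)
    (fun k x hx => by
      rw [← norm_iteratedFDeriv_one]
      refine (hbound 1 k x hx).trans ?_
      rw [add_comm 1 k, hB, mul_pow]
      calc (‖L‖ + 1) ^ k * (C * (k + 1).factorial * R ^ (k + 1))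
          ≤ (‖L‖ + 1) ^ (k + 1) * (C * (k + 1).factorial * R ^ (k + 1)) := by
            gcongr
            · linarith [norm_nonneg L]
            · exact Nat.le_succ k
        _ = _ := by ring)
  refine ⟨δ, hδ, fun Y => ∑' k, ckTerm (ContinuousLinearMap.proj ⟨m - 1, hm⟩) (projInit m) h k Y,
    fun X hX φ => ?_, fun φ => ?_, fun X hX => ?_⟩
  · have h1 := (LinearMap.toContinuousLinearMap φ).hasSum (hs X hX).hasSum
    convert! h1 using 1
    funext k
    exact congrArg (fun w => φ (((k.factorial : ℝ)⁻¹ * X ⟨m - 1, hm⟩ ^ k) • w))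
      (iterate_mul_diracTR_eqOn e isOpen_ball hV k (hP X hX))
  · exact (LinearMap.toContinuousLinearMap φ).contDiff.comp_contDiffOn hcd
  · rw [(hder X hX).diracR_eq]
    refine diracSymbol_tsum_ckTermDeriv_eq_zero hm (fun k => ?_) (hsd X hX) (hsf X hX)
    simp only [hh, Function.iterate_succ_apply']
    rfl

end Clifford

/-- **Explicit Cauchy–Kovalevskaya extension in Euclidean Clifford analysis.**
If `f̃` is real-analytic on an open set `Ω̃ ⊆ ℝ^{m-1}` containing the origin, then on some
open neighbourhood `U` of the origin in `ℝ^m` the series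
`f(X) = ∑ₖ (1/k!) X_mᵏ (e_m ∂̃)ᵏ[f̃](X₁,…,X_{m-1})` converges, the resulting function `f`
is monogenic on `U`, and `f` restricts to `f̃` on `{X_m = 0}` near the origin. -/
theorem ck_extension_monogenic_series
    (m : ℕ) (hm : 2 ≤ m)
    (Ωt : Set (Fin (m - 1) → ℝ)) (hΩt : IsOpen Ωt) (h0 : (0 : Fin (m - 1) → ℝ) ∈ Ωt)
    (ft : (Fin (m - 1) → ℝ) → ClR m) (hft : RealAnalyticOnR ft Ωt) :
    ∃ (U : Set (Fin m → ℝ)) (f : (Fin m → ℝ) → ClR m),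
      IsOpen U ∧ (0 : Fin m → ℝ) ∈ U ∧
      (∀ X ∈ U, ∀ φ : ClR m →ₗ[ℝ] ℝ,
        HasSum (fun k : ℕ => φ (((Nat.factorial k : ℝ))⁻¹ • (X ⟨m - 1, by omega⟩) ^ k •
          ((fun (g : (Fin (m - 1) → ℝ) → ClR m) (x : Fin (m - 1) → ℝ) =>
              er m ⟨m - 1, by omega⟩ * diracTR m g x)^[k] ft)
            (fun i : Fin (m - 1) => X (Fin.castLE (Nat.sub_le m 1) i))))
          (φ (f X))) ∧
      MonogenicOn m f U ∧
      (∀ x : Fin (m - 1) → ℝ, embR m x ∈ U → f (embR m x) = ft x) := by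
  obtain ⟨δ, hδ, f, hsum, hmono⟩ :=
    exists_ball_ckTerm_extension (by omega : m - 1 < m) h0 hft
  refine ⟨Metric.ball 0 δ, f, Metric.isOpen_ball, Metric.mem_ball_self hδ, fun X hX φ => ?_,
    hmono, fun x hx => ?_⟩
  · simpa only [smul_smul, projInit_apply] using hsum X hX φ
  · refine ClR.ext_linearMap fun φ => (hsum _ hx φ).unique ?_
    have hlast : embR m x ⟨m - 1, by omega⟩ = 0 := by simp [embR]
    rw [hlast, projInit_embR]
    convert hasSum_single 0 fun k hk => ?_ using 1
    · simp
    · simp [hk]
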